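/- arXiv:1902.09709 — 7 statements merged into one kernel-verified Lean document; each statement's English description precedes it below -/
import Mathlib

section
/- Let N_r ≥ 1 be an integer, N₀ > 0, and w_n, w_t, g_n, g_t > 0 be real numbers, and let θ_n, θ_t ∈ ℝ with sin(π(θ_t − θ_n)) ≠ 0. Define h_k = √(w_k g_k)·a(θ_k) ∈ ℂ^{N_r} and Σ_k = N₀·I + h_k·h_kᴴ for k ∈ {n, t}. Then det(Σ_t) / det(Σ_n + Σ_t) = 2^{−N_r} · (1 + w_t g_t/N₀) / [ (1 + w_n g_n/(2N₀))·(1 + w_t g_t/(2N₀)) − (w_n w_t g_n g_t/(4N₀²N_r²)) · sin²(πN_r(θ_t − θ_n))/sin²(π(θ_t − θ_n)) ], where both determinants are nonzero. -/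
open Matrix Finset

/-- Uniform-linear-array steering vector: `a(θ)_k = (1/√N_r)·exp(−2πi·θ·(k − (N_r−1)/2))`
for `k = 0, …, N_r−1`. -/
noncomputable def steering (N : ℕ) (θ : ℝ) : Fin N → ℂ := fun k =>
  ((1 / Real.sqrt N : ℝ) : ℂ) *
    Complex.exp ((-2) * (Real.pi : ℂ) * Complex.I * (θ : ℂ) *
      (((k : ℕ) : ℂ) - ((N : ℂ) - 1) / 2))

/-- The single-path received-signal covariance matrix
`Σ = N₀·I + h·hᴴ` with `h = √(w·g)·a(θ)`. -/
noncomputable def covMatrix (Nr : ℕ) (N₀ w g θ : ℝ) : Matrix (Fin Nr) (Fin Nr) ℂ :=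
  (N₀ : ℂ) • (1 : Matrix (Fin Nr) (Fin Nr) ℂ) +
    Matrix.vecMulVec ((Real.sqrt (w * g) : ℂ) • steering Nr θ)
      (star ((Real.sqrt (w * g) : ℂ) • steering Nr θ))

open scoped ComplexOrder

lemma aux_det_two (N : ℕ) (c : ℂ) (hc : c ≠ 0) (u₁ v₁ u₂ v₂ : Fin N → ℂ) :
    (c • (1 : Matrix (Fin N) (Fin N) ℂ) + vecMulVec u₁ v₁ + vecMulVec u₂ v₂).det =
      c ^ N * ((1 + (v₁ ⬝ᵥ u₁) / c) * (1 + (v₂ ⬝ᵥ u₂) / c)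
        - (v₁ ⬝ᵥ u₂) * (v₂ ⬝ᵥ u₁) / c ^ 2) := by
  have h : c • (1 : Matrix (Fin N) (Fin N) ℂ) + vecMulVec u₁ v₁ + vecMulVec u₂ v₂ =
      c • (1 + (Matrix.of ![u₁, u₂])ᵀ * (c⁻¹ • Matrix.of ![v₁, v₂])) := by
    ext i j
    simp [Matrix.mul_apply, vecMulVec_apply, Fin.sum_univ_two]
    field_simp
    ring
  have hm : ∀ i j : Fin 2, ((c⁻¹ • Matrix.of ![v₁, v₂]) * (Matrix.of ![u₁, u₂])ᵀ) i j =
      c⁻¹ * (![v₁, v₂] i ⬝ᵥ ![u₁, u₂] j) := by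
    intro i j
    rw [Matrix.smul_mul, Matrix.smul_apply, smul_eq_mul]
    rfl
  rw [h, det_smul, det_one_add_mul_comm, det_fin_two, Fintype.card_fin]
  simp only [Matrix.add_apply, hm]
  simp
  left
  field_simp

lemma aux_dirichlet (N : ℕ) (x : ℂ) :
    (∑ k : Fin N, Complex.exp ((-2) * Complex.I * x * (((k : ℕ) : ℂ) - ((N : ℂ) - 1) / 2)))
      * Complex.sin x = Complex.sin (N * x) := by
  rw [Fin.sum_univ_eq_sum_range
    (fun k : ℕ => Complex.exp ((-2) * Complex.I * x * ((k : ℂ) - ((N : ℂ) - 1) / 2))) N,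
    Finset.sum_mul]
  have key : ∀ k : ℕ, Complex.exp ((-2) * Complex.I * x * ((k : ℂ) - ((N : ℂ) - 1) / 2))
      * Complex.sin x =
      Complex.exp ((-2) * Complex.I * x * (((k + 1 : ℕ) : ℂ) - N / 2)) * Complex.I / 2 -
      Complex.exp ((-2) * Complex.I * x * ((k : ℂ) - N / 2)) * Complex.I / 2 := by
    intro k
    have e1 : (-2) * Complex.I * x * (((k + 1 : ℕ) : ℂ) - N / 2) =
      (-2) * Complex.I * x * ((k : ℂ) - ((N : ℂ) - 1) / 2) + -x * Complex.I := by
      push_cast; ring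
    have e2 : (-2) * Complex.I * x * ((k : ℂ) - N / 2) =
      (-2) * Complex.I * x * ((k : ℂ) - ((N : ℂ) - 1) / 2) + x * Complex.I := by ring
    rw [e1, e2, Complex.exp_add, Complex.exp_add, Complex.sin]
    ring
  rw [Finset.sum_congr rfl (fun k _ => key k),
    Finset.sum_range_sub (fun k : ℕ =>
      Complex.exp ((-2) * Complex.I * x * ((k : ℂ) - N / 2)) * Complex.I / 2), Complex.sin]
  have e1 : (-2) * Complex.I * x * ((N : ℂ) - N / 2) = -(N * x) * Complex.I := by ring
  have e2 : (-2) * Complex.I * x * (((0 : ℕ) : ℂ) - N / 2) = (N * x) * Complex.I := by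
    push_cast; ring
  rw [e1, e2]
  ring

lemma aux_inner (N : ℕ) (θ φ : ℝ) :
    star (steering N θ) ⬝ᵥ steering N φ = (1 / N : ℂ) *
      ∑ k : Fin N, Complex.exp ((-2) * Complex.I * ((Real.pi * (φ - θ) : ℝ) : ℂ) *
        (((k : ℕ) : ℂ) - ((N : ℂ) - 1) / 2)) := by
  rw [dotProduct, Finset.mul_sum]
  refine Finset.sum_congr rfl fun k _ => ?_
  have hs : ((1 / Real.sqrt N : ℝ) : ℂ) * ((1 / Real.sqrt N : ℝ) : ℂ) = 1 / N := by
    rw [← Complex.ofReal_mul, div_mul_div_comm, Real.mul_self_sqrt (Nat.cast_nonneg N)]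
    simp
  rw [Pi.star_apply, steering, steering, star_mul', Complex.star_def,
    Complex.conj_ofReal, ← Complex.exp_conj, mul_mul_mul_comm, hs, ← Complex.exp_add]
  congr 2
  simp only [map_mul, map_sub, map_div₀, map_neg, Complex.conj_I, Complex.conj_ofReal, map_one,
    Complex.conj_natCast, Complex.conj_ofNat]
  push_cast
  ring

lemma aux_self (N : ℕ) (hN : 1 ≤ N) (θ : ℝ) :
    star (steering N θ) ⬝ᵥ steering N θ = 1 := by
  have : (N : ℂ) ≠ 0 := by exact_mod_cast (by omega : N ≠ 0)
  rw [aux_inner]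
  simp [this]

lemma aux_cross (N : ℕ) (θ φ : ℝ) (h : Real.sin (Real.pi * (φ - θ)) ≠ 0) :
    star (steering N θ) ⬝ᵥ steering N φ =
      ((Real.sin (Real.pi * N * (φ - θ)) / (N * Real.sin (Real.pi * (φ - θ))) : ℝ) : ℂ) := by
  have h' : Complex.sin ((Real.pi * (φ - θ) : ℝ) : ℂ) ≠ 0 := by exact_mod_cast h
  have d := aux_dirichlet N ((Real.pi * (φ - θ) : ℝ) : ℂ)
  rw [aux_inner, eq_div_of_mul_eq h' d]
  have e : Real.pi * N * (φ - θ) = N * (Real.pi * (φ - θ)) := by ring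
  rw [e, div_mul_div_comm, one_mul]
  push_cast
  rfl

lemma aux_dot_smul (N : ℕ) (r s : ℝ) (u v : Fin N → ℂ) :
    star ((r : ℂ) • u) ⬝ᵥ ((s : ℂ) • v) = ((r * s : ℝ) : ℂ) * (star u ⬝ᵥ v) := by
  rw [star_smul, smul_dotProduct, dotProduct_smul, Complex.star_def, Complex.conj_ofReal]
  simp [mul_assoc]

lemma aux_posDef (N : ℕ) (N₀ w g θ : ℝ) (h : 0 < N₀) : (covMatrix N N₀ w g θ).PosDef := by
  unfold covMatrix
  refine Matrix.PosDef.add_posSemidef ?_ (Matrix.posSemidef_vecMulVec_self_star _)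
  exact Matrix.PosDef.one.smul (by exact_mod_cast h)

/-- Ratio of covariance determinants in the SPIM-mmWave mutual-information
approximation: both determinants are nonzero and
`det(Σ_t)/det(Σ_n + Σ_t) = 2^{−N_r}·(1 + w_t g_t/N₀) /
[(1 + w_n g_n/(2N₀))(1 + w_t g_t/(2N₀)) −
 (w_n w_t g_n g_t/(4N₀²N_r²))·sin²(πN_r(θ_t−θ_n))/sin²(π(θ_t−θ_n))]`. -/
theorem det_ratio_covariances (Nr : ℕ) (hNr : 1 ≤ Nr) (N₀ wn wt gn gt θn θt : ℝ)
    (hN₀ : 0 < N₀) (hwn : 0 < wn) (hwt : 0 < wt) (hgn : 0 < gn) (hgt : 0 < gt)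
    (hθ : Real.sin (Real.pi * (θt - θn)) ≠ 0) :
    Matrix.det (covMatrix Nr N₀ wt gt θt) ≠ 0 ∧
    Matrix.det (covMatrix Nr N₀ wn gn θn + covMatrix Nr N₀ wt gt θt) ≠ 0 ∧
    Matrix.det (covMatrix Nr N₀ wt gt θt) /
        Matrix.det (covMatrix Nr N₀ wn gn θn + covMatrix Nr N₀ wt gt θt) =
      ((((2 : ℝ) ^ Nr)⁻¹ * (1 + wt * gt / N₀) /
          ((1 + wn * gn / (2 * N₀)) * (1 + wt * gt / (2 * N₀))
            - wn * wt * gn * gt / (4 * N₀ ^ 2 * (Nr : ℝ) ^ 2) *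
              (Real.sin (Real.pi * Nr * (θt - θn)) ^ 2 /
                Real.sin (Real.pi * (θt - θn)) ^ 2)) : ℝ) : ℂ) := by
  refine ⟨(aux_posDef Nr N₀ wt gt θt hN₀).det_pos.ne',
    ((aux_posDef Nr N₀ wn gn θn hN₀).add (aux_posDef Nr N₀ wt gt θt hN₀)).det_pos.ne', ?_⟩
  have hc : (N₀ : ℂ) ≠ 0 := by exact_mod_cast hN₀.ne'
  have hc2 : (2 * N₀ : ℂ) ≠ 0 := mul_ne_zero two_ne_zero hc
  have hθ' : Real.sin (Real.pi * (θn - θt)) ≠ 0 := by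
    rw [← neg_sub θt θn, mul_neg, Real.sin_neg]
    exact neg_ne_zero.mpr hθ
  have sn : Real.sqrt (wn * gn) * Real.sqrt (wn * gn) = wn * gn :=
    Real.mul_self_sqrt (by positivity)
  have st : Real.sqrt (wt * gt) * Real.sqrt (wt * gt) = wt * gt :=
    Real.mul_self_sqrt (by positivity)
  have h1 : (covMatrix Nr N₀ wt gt θt).det =
      ((N₀ ^ Nr * (1 + wt * gt / N₀) : ℝ) : ℂ) := by
    have := aux_det_two Nr N₀ hc ((Real.sqrt (wt * gt) : ℂ) • steering Nr θt)
      (star ((Real.sqrt (wt * gt) : ℂ) • steering Nr θt)) 0 0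
    rw [aux_dot_smul, aux_self Nr hNr, st] at this
    simpa [covMatrix] using this
  have h2 : (covMatrix Nr N₀ wn gn θn + covMatrix Nr N₀ wt gt θt).det =
      (((2 * N₀) ^ Nr * ((1 + wn * gn / (2 * N₀)) * (1 + wt * gt / (2 * N₀))
            - wn * wt * gn * gt / (4 * N₀ ^ 2 * (Nr : ℝ) ^ 2) *
              (Real.sin (Real.pi * Nr * (θt - θn)) ^ 2 /
                Real.sin (Real.pi * (θt - θn)) ^ 2)) : ℝ) : ℂ) := by
    have := aux_det_two Nr (2 * N₀) hc2 ((Real.sqrt (wn * gn) : ℂ) • steering Nr θn)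
      (star ((Real.sqrt (wn * gn) : ℂ) • steering Nr θn))
      ((Real.sqrt (wt * gt) : ℂ) • steering Nr θt)
      (star ((Real.sqrt (wt * gt) : ℂ) • steering Nr θt))
    rw [aux_dot_smul, aux_dot_smul, aux_dot_smul, aux_dot_smul, aux_self Nr hNr,
      aux_self Nr hNr, st, sn, aux_cross Nr θn θt hθ, aux_cross Nr θt θn hθ'] at this
    have e : covMatrix Nr N₀ wn gn θn + covMatrix Nr N₀ wt gt θt =
        (2 * N₀ : ℂ) • (1 : Matrix (Fin Nr) (Fin Nr) ℂ) +
        vecMulVec ((Real.sqrt (wn * gn) : ℂ) • steering Nr θn)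
          (star ((Real.sqrt (wn * gn) : ℂ) • steering Nr θn)) +
        vecMulVec ((Real.sqrt (wt * gt) : ℂ) • steering Nr θt)
          (star ((Real.sqrt (wt * gt) : ℂ) • steering Nr θt)) := by
      unfold covMatrix
      rw [two_mul, add_smul]
      abel
    rw [e, this]
    have e1 : Real.sin (Real.pi * (θn - θt)) = -Real.sin (Real.pi * (θt - θn)) := by
      rw [← Real.sin_neg]; congr 1; ring
    have e2 : Real.sin (Real.pi * Nr * (θn - θt)) = -Real.sin (Real.pi * Nr * (θt - θn)) := by
      rw [← Real.sin_neg]; congr 1; ring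
    rw [e1, e2]
    generalize Real.sin (Real.pi * (θt - θn)) = a
    generalize Real.sin (Real.pi * Nr * (θt - θn)) = b
    have key : Real.sqrt (wn * gn) * Real.sqrt (wt * gt) * (b / (Nr * a)) *
        (Real.sqrt (wt * gt) * Real.sqrt (wn * gn) * (-b / (Nr * -a))) / (2 * N₀) ^ 2 =
        wn * wt * gn * gt / (4 * N₀ ^ 2 * (Nr : ℝ) ^ 2) * (b ^ 2 / a ^ 2) := by
      calc _ = (Real.sqrt (wn * gn) * Real.sqrt (wn * gn)) *
            (Real.sqrt (wt * gt) * Real.sqrt (wt * gt)) * (b / (Nr * a)) ^ 2 / (2 * N₀) ^ 2 := by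
            rw [mul_neg, neg_div_neg_eq]; ring
        _ = _ := by rw [sn, st]; ring
    rw [← key]
    push_cast
    ring
  rw [h1, h2, ← Complex.ofReal_div]
  congr 1
  rw [mul_pow, mul_assoc, mul_left_comm, mul_div_mul_left _ _ (pow_ne_zero _ hN₀.ne')]
  rw [div_mul_eq_div_div, div_eq_inv_mul (1 + wt * gt / N₀)]
end

section
/- Let w₁, w₂, g₁, g₂ > 0 and q ∈ [0, 1) be real numbers. For N₀ > 0 define D₁₂(N₀) = (1 + w₁g₁/(2N₀))·(1 + w₂g₂/(2N₀)) − q·w₁g₁w₂g₂/(4N₀²), D_nn(N₀) = 1 + w_n g_n/N₀ for n ∈ {1,2}, I_SPIM(N₀) = 1 − (1/2)·Σ_{n=1}^{2} log₂( D_nn(N₀)^{−1} + D₁₂(N₀)^{−1} ), and I_mmWave(N₀) = log₂(1 + w₁g₁/N₀). Then I_SPIM(N₀) − I_mmWave(N₀) converges to 1 + (1/2)·log₂( w₂g₂/(w₁g₁) ) as N₀ → 0⁺ (limit along positive N₀ tending to 0). -/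
open Filter Set

/-- High-SNR asymptotics for the two-path SPIM-mmWave spectral-efficiency gap:
`I_SPIM(N₀) − I_mmWave(N₀) → 1 + (1/2)·log₂(w₂g₂/(w₁g₁))` as `N₀ → 0⁺`. -/
theorem spim_minus_mmwave_tendsto (w₁ w₂ g₁ g₂ q : ℝ)
    (hw₁ : 0 < w₁) (hw₂ : 0 < w₂) (hg₁ : 0 < g₁) (hg₂ : 0 < g₂)
    (hq0 : 0 ≤ q) (hq1 : q < 1) :
    Tendsto (fun N₀ : ℝ =>
        (1 - (1 / 2) *
          (Real.logb 2 ((1 + w₁ * g₁ / N₀)⁻¹ +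
              ((1 + w₁ * g₁ / (2 * N₀)) * (1 + w₂ * g₂ / (2 * N₀))
                - q * w₁ * g₁ * w₂ * g₂ / (4 * N₀ ^ 2))⁻¹)
            + Real.logb 2 ((1 + w₂ * g₂ / N₀)⁻¹ +
              ((1 + w₁ * g₁ / (2 * N₀)) * (1 + w₂ * g₂ / (2 * N₀))
                - q * w₁ * g₁ * w₂ * g₂ / (4 * N₀ ^ 2))⁻¹)))
          - Real.logb 2 (1 + w₁ * g₁ / N₀))
      (nhdsWithin 0 (Set.Ioi 0))
      (nhds (1 + (1 / 2) * Real.logb 2 (w₂ * g₂ / (w₁ * g₁)))) := by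
  obtain ⟨a, ha⟩ : ∃ a, a = w₁ * g₁ := ⟨_, rfl⟩
  obtain ⟨b, hb⟩ : ∃ b, b = w₂ * g₂ := ⟨_, rfl⟩
  have ha0 : 0 < a := ha ▸ mul_pos hw₁ hg₁
  have hb0 : 0 < b := hb ▸ mul_pos hw₂ hg₂
  have hab : q * w₁ * g₁ * w₂ * g₂ = q * (a * b) := by rw [ha, hb]; ring
  rw [hab, ← ha, ← hb]
  have hab0 : 0 < a * b := mul_pos ha0 hb0
  have hq' : 0 < (1 - q) * (a * b) := mul_pos (by linarith) hab0
  have hE : ∀ x : ℝ, 0 ≤ x → 0 < (2 * x + a) * (2 * x + b) - q * (a * b) := by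
    intro x hx
    have h1 := mul_nonneg hx hx
    have h2 := mul_nonneg hx ha0.le
    have h3 := mul_nonneg hx hb0.le
    nlinarith
  have hsum : ∀ c : ℝ, 0 < c → ∀ x : ℝ, 0 < x →
      Real.logb 2 ((1 + c / x)⁻¹ +
        ((1 + a / (2 * x)) * (1 + b / (2 * x)) - q * (a * b) / (4 * x ^ 2))⁻¹)
      = Real.logb 2 x + Real.logb 2
        ((x + c)⁻¹ + 4 * x * ((2 * x + a) * (2 * x + b) - q * (a * b))⁻¹) := by
    intro c hc x hx
    have h := hE x hx.le
    have hxc : 0 < x + c := by linarith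
    have h1 : (1 + c / x)⁻¹ = x * (x + c)⁻¹ := by
      have : 1 + c / x = (x + c) / x := by field_simp
      rw [this, inv_div, div_eq_mul_inv]
    have h2 : ((1 + a / (2 * x)) * (1 + b / (2 * x)) - q * (a * b) / (4 * x ^ 2))⁻¹
        = 4 * x ^ 2 * ((2 * x + a) * (2 * x + b) - q * (a * b))⁻¹ := by
      have : (1 + a / (2 * x)) * (1 + b / (2 * x)) - q * (a * b) / (4 * x ^ 2)
          = ((2 * x + a) * (2 * x + b) - q * (a * b)) / (4 * x ^ 2) := by
        field_simp
        ring
      rw [this, inv_div, div_eq_mul_inv]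
    rw [h1, h2, ← Real.logb_mul hx.ne' (by positivity)]
    congr 1
    ring
  have hlim : ∀ c : ℝ, 0 < c → Tendsto (fun x : ℝ => Real.logb 2
      ((x + c)⁻¹ + 4 * x * ((2 * x + a) * (2 * x + b) - q * (a * b))⁻¹))
      (nhdsWithin 0 (Set.Ioi 0)) (nhds (-Real.logb 2 c)) := by
    intro c hc
    have h0 := (hE 0 le_rfl).ne'
    have hcont : ContinuousAt (fun x : ℝ =>
        ((x + c)⁻¹ + 4 * x * ((2 * x + a) * (2 * x + b) - q * (a * b))⁻¹)) 0 := by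
      refine ContinuousAt.add (ContinuousAt.inv₀ (by fun_prop) (by simpa using hc.ne'))
        (ContinuousAt.mul (by fun_prop) (ContinuousAt.inv₀ (by fun_prop) h0))
    have ht := hcont.tendsto.mono_left (nhdsWithin_le_nhds (s := Set.Ioi (0 : ℝ)))
    simp only [zero_add, mul_zero, zero_mul, add_zero] at ht
    have hl := (Real.continuousAt_log (inv_pos.mpr hc).ne').tendsto.comp ht
    have := hl.div_const (Real.log 2)
    rw [← Real.logb_inv]
    exact this
  have hlast : Tendsto (fun x : ℝ => Real.logb 2 (x + a))
      (nhdsWithin 0 (Set.Ioi 0)) (nhds (Real.logb 2 a)) := by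
    have hcont : ContinuousAt (fun x : ℝ => x + a) 0 := by fun_prop
    have ht := hcont.tendsto.mono_left (nhdsWithin_le_nhds (s := Set.Ioi (0 : ℝ)))
    simp only [zero_add] at ht
    exact ((Real.continuousAt_log ha0.ne').tendsto.comp ht).div_const (Real.log 2)
  have hmain := ((((hlim a ha0).add (hlim b hb0)).const_mul (1 / 2 : ℝ)).const_sub 1).sub hlast
  have hval : 1 + (1 / 2) * Real.logb 2 (b / a)
      = 1 - 1 / 2 * (-Real.logb 2 a + -Real.logb 2 b) - Real.logb 2 a := by
    rw [Real.logb_div hb0.ne' ha0.ne']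
    ring
  rw [hval]
  refine hmain.congr' ?_
  filter_upwards [self_mem_nhdsWithin] with x hx
  have hx0 : 0 < x := hx
  have h1 : 1 + a / x = (x + a) / x := by field_simp
  rw [hsum a ha0 x hx0, hsum b hb0 x hx0, h1, Real.logb_div (by positivity) hx0.ne']
  ring
end

section
/- Let w₁, w₂, g₁, g₂ > 0 and q ∈ [0, 1) be real numbers, and define D₁₂, D_nn, I_SPIM, and I_mmWave as functions of N₀ > 0 by D₁₂(N₀) = (1 + w₁g₁/(2N₀))·(1 + w₂g₂/(2N₀)) − q·w₁g₁w₂g₂/(4N₀²), D_nn(N₀) = 1 + w_n g_n/N₀, I_SPIM(N₀) = 1 − (1/2)·Σ_{n=1}^{2} log₂( D_nn(N₀)^{−1} + D₁₂(N₀)^{−1} ), I_mmWave(N₀) = log₂(1 + w₁g₁/N₀). If w₁g₁ < 4·w₂g₂, then there exists ε > 0 such that for all N₀ with 0 < N₀ < ε, I_SPIM(N₀) > I_mmWave(N₀). (Theorem 1: in the high-SNR region, SPIM-mmWave strictly outperforms conventional mmWave beamforming whenever the strongest path gain does not exceed four times the second path gain.) -/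
open Filter Set

/-- Theorem 1: if `w₁g₁ < 4·w₂g₂`, then in the high-SNR region (all sufficiently
small `N₀ > 0`) the SPIM-mmWave spectral efficiency strictly exceeds that of
conventional mmWave beamforming. -/
theorem spim_beats_mmwave_high_snr (w₁ w₂ g₁ g₂ q : ℝ)
    (hw₁ : 0 < w₁) (hw₂ : 0 < w₂) (hg₁ : 0 < g₁) (hg₂ : 0 < g₂)
    (hq0 : 0 ≤ q) (hq1 : q < 1)
    (hcond : w₁ * g₁ < 4 * (w₂ * g₂)) :
    ∃ ε > 0, ∀ N₀ : ℝ, 0 < N₀ → N₀ < ε →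
      (1 - (1 / 2) *
        (Real.logb 2 ((1 + w₁ * g₁ / N₀)⁻¹ +
            ((1 + w₁ * g₁ / (2 * N₀)) * (1 + w₂ * g₂ / (2 * N₀))
              - q * w₁ * g₁ * w₂ * g₂ / (4 * N₀ ^ 2))⁻¹)
          + Real.logb 2 ((1 + w₂ * g₂ / N₀)⁻¹ +
            ((1 + w₁ * g₁ / (2 * N₀)) * (1 + w₂ * g₂ / (2 * N₀))
              - q * w₁ * g₁ * w₂ * g₂ / (4 * N₀ ^ 2))⁻¹)))
        > Real.logb 2 (1 + w₁ * g₁ / N₀) := by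
  obtain ⟨a, ha'⟩ : ∃ a, a = w₁ * g₁ := ⟨_, rfl⟩
  obtain ⟨b, hb'⟩ : ∃ b, b = w₂ * g₂ := ⟨_, rfl⟩
  have hqab : q * w₁ * g₁ * w₂ * g₂ = q * a * b := by rw [ha', hb']; ring
  have ha : 0 < a := by rw [ha']; positivity
  have hb : 0 < b := by rw [hb']; positivity
  rw [hqab]
  rw [← ha', ← hb'] at hcond ⊢
  have hab : 0 < (1 - q) * a * b := mul_pos (mul_pos (by linarith) ha) hb
  let P : ℝ → ℝ := fun N => 4 * N ^ 2 + 2 * N * (a + b) + (1 - q) * a * b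
  let F : ℝ → ℝ := fun N =>
    (1 + 4 * N * (N + a) / P N) * ((N + a) / (N + b) + 4 * N * (N + a) / P N)
  have hP0 : P 0 ≠ 0 := by simp only [P]; nlinarith
  have hPc : Continuous P := by simp only [P]; fun_prop
  have hFc : ContinuousAt F 0 := by
    have h1 : ContinuousAt (fun N : ℝ => 4 * N * (N + a) / P N) 0 :=
      ContinuousAt.div (by fun_prop) hPc.continuousAt hP0
    have h2 : ContinuousAt (fun N : ℝ => (N + a) / (N + b)) 0 :=
      ContinuousAt.div (by fun_prop) (by fun_prop) (by simpa using hb.ne')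
    exact (continuousAt_const.add h1).mul (h2.add h1)
  have hF0 : F 0 < 4 := by
    simp only [F]
    simp only [mul_zero, zero_mul, zero_div, zero_add, add_zero, one_mul]
    rw [div_lt_iff₀ hb]; exact hcond
  have hev := hFc.eventually (gt_mem_nhds hF0)
  obtain ⟨ε, hε, h⟩ := Metric.eventually_nhds_iff.1 hev
  refine ⟨ε, hε, fun N hN hNε => ?_⟩
  have hFN : F N < 4 := h (by rw [Real.dist_eq, sub_zero, abs_of_pos hN]; exact hNε)
  have hPN : 0 < P N := by simp only [P]; positivity
  have hD : (1 + a / (2 * N)) * (1 + b / (2 * N)) - q * a * b / (4 * N ^ 2)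
      = P N / (4 * N ^ 2) := by
    simp only [P]; field_simp; ring
  rw [hD]
  have hC : 0 < 1 + a / N := by positivity
  have hE : 0 < 1 + b / N := by positivity
  have hDp : 0 < P N / (4 * N ^ 2) := by positivity
  have hA : 0 < (1 + a / N)⁻¹ + (P N / (4 * N ^ 2))⁻¹ := by positivity
  have hB : 0 < (1 + b / N)⁻¹ + (P N / (4 * N ^ 2))⁻¹ := by positivity
  have key : ((1 + a / N)⁻¹ + (P N / (4 * N ^ 2))⁻¹) *
      ((1 + b / N)⁻¹ + (P N / (4 * N ^ 2))⁻¹) * (1 + a / N) ^ 2 = F N := by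
    have e1 : 1 + a / N = (N + a) / N := by field_simp
    have e2 : 1 + b / N = (N + b) / N := by field_simp
    have h1 : N + a ≠ 0 := by positivity
    have h2 : N + b ≠ 0 := by positivity
    have h3 := hPN.ne'
    simp only [F]
    rw [e1, e2]
    generalize P N = p at *
    field_simp
  have hlog : Real.logb 2 (((1 + a / N)⁻¹ + (P N / (4 * N ^ 2))⁻¹) *
      ((1 + b / N)⁻¹ + (P N / (4 * N ^ 2))⁻¹) * (1 + a / N) ^ 2) < Real.logb 2 4 :=
    Real.logb_lt_logb (by norm_num) (by positivity) (by rw [key]; exact hFN)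
  have h4 : Real.logb 2 4 = 2 := by
    rw [show (4 : ℝ) = 2 ^ (2 : ℕ) by norm_num, Real.logb_pow, Real.logb_self_eq_one (by norm_num)]
    norm_num
  rw [h4, Real.logb_mul (mul_pos hA hB).ne' (by positivity), Real.logb_mul hA.ne' hB.ne',
    Real.logb_pow] at hlog
  push_cast at hlog
  linarith
end

section
/- Let M ≥ 2 be an integer, N₀ > 0, and w_n, g_n > 0 for n = 1, …, M. Define I_SPIM(M, N₀) = log₂ M − (1/M)·Σ_{n=1}^{M} log₂[ (1 + w_n g_n/N₀)^{−1} + Σ_{t ≠ n} ( (1 + w_n g_n/(2N₀))·(1 + w_t g_t/(2N₀)) )^{−1} ]. Then I_SPIM(M, N₀) ≥ log₂ M + (1/M)·Σ_{n=1}^{M} log₂(1 + w_n g_n/N₀) − (4N₀(M−1)·log₂ e / M)·Σ_{t=1}^{M} (w_t g_t)^{−1}, where log₂ e = 1/ln 2. -/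
open Finset

/-- Key intermediate inequality in the proof of Theorem 2: for `M ≥ 2` spatial
paths with gains `w_n g_n > 0`,
`I_SPIM(M, N₀) ≥ log₂ M + (1/M)·Σ_n log₂(1 + w_n g_n/N₀)
  − (4N₀(M−1)·log₂ e / M)·Σ_t (w_t g_t)⁻¹` where `log₂ e = 1/ln 2`. -/
theorem spim_se_lower_bound (M : ℕ) (hM : 2 ≤ M) (N₀ : ℝ) (hN₀ : 0 < N₀)
    (w g : ℕ → ℝ) (hw : ∀ n ∈ Finset.Icc 1 M, 0 < w n)
    (hg : ∀ n ∈ Finset.Icc 1 M, 0 < g n) :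
    Real.logb 2 M - (1 / M) * ∑ n ∈ Finset.Icc 1 M,
        Real.logb 2 ((1 + w n * g n / N₀)⁻¹ +
          ∑ t ∈ (Finset.Icc 1 M).erase n,
            ((1 + w n * g n / (2 * N₀)) * (1 + w t * g t / (2 * N₀)))⁻¹) ≥
      Real.logb 2 M + (1 / M) * ∑ n ∈ Finset.Icc 1 M,
          Real.logb 2 (1 + w n * g n / N₀)
        - (4 * N₀ * (M - 1) * (Real.log 2)⁻¹ / M) *
            ∑ t ∈ Finset.Icc 1 M, (w t * g t)⁻¹ := by
  have hc : ∀ n ∈ Finset.Icc 1 M, 0 < w n * g n := fun n hn => mul_pos (hw n hn) (hg n hn)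
  generalize hcd : (fun n => w n * g n) = c at *
  have hcn : ∀ n, w n * g n = c n := fun n => congrFun hcd n
  simp only [hcn] at hc ⊢
  have hl : 0 < Real.log 2 := Real.log_pos (by norm_num)
  have key : ∀ n ∈ Finset.Icc 1 M,
      Real.logb 2 ((1 + c n / N₀)⁻¹ + ∑ t ∈ (Finset.Icc 1 M).erase n,
        ((1 + c n / (2 * N₀)) * (1 + c t / (2 * N₀)))⁻¹) ≤
      -Real.logb 2 (1 + c n / N₀) +
        4 * N₀ * (Real.log 2)⁻¹ * (∑ t ∈ Finset.Icc 1 M, (c t)⁻¹ - (c n)⁻¹) := by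
    intro n hn
    have hcn' := hc n hn
    have hB : 0 < 1 + c n / N₀ := by positivity
    have hS : ∑ t ∈ (Finset.Icc 1 M).erase n,
        ((1 + c n / (2 * N₀)) * (1 + c t / (2 * N₀)))⁻¹ ≤
        (1 + c n / N₀)⁻¹ * (4 * N₀ * (∑ t ∈ Finset.Icc 1 M, (c t)⁻¹ - (c n)⁻¹)) := by
      rw [← Finset.add_sum_erase _ _ hn, add_sub_cancel_left, Finset.mul_sum, Finset.mul_sum]
      apply Finset.sum_le_sum
      intro t ht
      have hct := hc t (Finset.mem_of_mem_erase ht)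
      have h1 : (1 + c n / (2 * N₀))⁻¹ ≤ 2 * (1 + c n / N₀)⁻¹ := by
        rw [← div_eq_mul_inv, inv_eq_one_div, div_le_div_iff₀ (by positivity) hB]
        have : c n / (2 * N₀) = c n / N₀ / 2 := by field_simp
        rw [this]; linarith
      have h2 : (1 + c t / (2 * N₀))⁻¹ ≤ 2 * N₀ * (c t)⁻¹ := by
        rw [← div_eq_mul_inv, ← inv_div (c t) (2 * N₀)]
        exact inv_anti₀ (by positivity) (by linarith)
      rw [mul_inv]
      calc _ ≤ (2 * (1 + c n / N₀)⁻¹) * (2 * N₀ * (c t)⁻¹) :=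
            mul_le_mul h1 h2 (by positivity) (by positivity)
        _ = _ := by ring
    have hS0 : 0 ≤ ∑ t ∈ (Finset.Icc 1 M).erase n,
        ((1 + c n / (2 * N₀)) * (1 + c t / (2 * N₀)))⁻¹ := by
      apply Finset.sum_nonneg
      intro t ht
      have hct := hc t (Finset.mem_of_mem_erase ht)
      positivity
    have hBi : 0 < (1 + c n / N₀)⁻¹ := inv_pos.mpr hB
    generalize (∑ t ∈ Finset.Icc 1 M, (c t)⁻¹ - (c n)⁻¹) = D at *
    generalize (∑ t ∈ (Finset.Icc 1 M).erase n,
        ((1 + c n / (2 * N₀)) * (1 + c t / (2 * N₀)))⁻¹) = S at *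
    have hle : Real.log ((1 + c n / N₀)⁻¹ + S) ≤ -Real.log (1 + c n / N₀) + 4 * N₀ * D := by
      rw [Real.log_le_iff_le_exp (by positivity), Real.exp_add, Real.exp_neg, Real.exp_log hB]
      have := Real.add_one_le_exp (4 * N₀ * D)
      nlinarith [mul_le_mul_of_nonneg_left this hBi.le]
    have := mul_le_mul_of_nonneg_right hle (inv_pos.mpr hl).le
    simp only [Real.logb, div_eq_mul_inv] at this ⊢
    linarith
  have hsum := Finset.sum_le_sum key
  rw [Finset.sum_add_distrib, Finset.sum_neg_distrib, ← Finset.mul_sum,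
    Finset.sum_sub_distrib, Finset.sum_const, Nat.card_Icc, nsmul_eq_mul, Nat.add_sub_cancel] at hsum
  have h := mul_le_mul_of_nonneg_left hsum (show (0:ℝ) ≤ 1 / M by positivity)
  have e : ∀ L S : ℝ, 1 / (M:ℝ) * (-L + 4 * N₀ * (Real.log 2)⁻¹ * (M * S - S)) =
      -(1 / M * L) + (4 * N₀ * (M - 1) * (Real.log 2)⁻¹ / M) * S := by
    intro L S; ring
  rw [e] at h
  linarith
end

section
/- Let M ≥ 2 be an integer, N₀ > 0, and w_n, g_n > 0 for n = 1, …, M with w₁g₁ ≥ w_n g_n for all n. Define I_SPIM(M, N₀) = log₂ M − (1/M)·Σ_{n=1}^{M} log₂[ (1 + w_n g_n/N₀)^{−1} + Σ_{t ≠ n} ( (1 + w_n g_n/(2N₀))·(1 + w_t g_t/(2N₀)) )^{−1} ]. If ( Π_{n=2}^{M} w_n g_n )^{1/(M−1)} > M^{−M/(M−1)} · exp( 4N₀ · Σ_{n=1}^{M} (w_n g_n)^{−1} ) · w₁g₁, then I_SPIM(M, N₀) > log₂(1 + w₁g₁/N₀). (Theorem 2: SPIM-mmWave with M spatial paths outperforms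 conventional mmWave beamforming whenever the geometric mean of the effective gains of the non-dominant paths exceeds τ times the effective gain of the dominant path, with τ = M^{−M/(M−1)}·exp(4N₀·Σ_n (w_n g_n)^{−1}).) -/
open Finset

/-- Per-path bound, with `a n` the effective gains. -/
lemma spim_path_bound (M : ℕ) (N : ℝ) (hN : 0 < N) (a : ℕ → ℝ)
    (ha : ∀ n ∈ Finset.Icc 1 M, 0 < a n) (hd : ∀ n ∈ Finset.Icc 1 M, a n ≤ a 1)
    (n : ℕ) (hn : n ∈ Finset.Icc 1 M) :
    Real.log ((1 + a n / N)⁻¹ + ∑ t ∈ (Finset.Icc 1 M).erase n,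
        ((1 + a n / (2 * N)) * (1 + a t / (2 * N)))⁻¹)
      ≤ 4 * N * (∑ t ∈ Finset.Icc 1 M, (a t)⁻¹) - 4 * N * (a n)⁻¹
        - Real.log (a n) + Real.log (a 1) - Real.log (1 + a 1 / N) := by
  have han := ha n hn
  have hdn := hd n hn
  have ha1 : 0 < a 1 := lt_of_lt_of_le han hdn
  have hsum : ∑ t ∈ (Finset.Icc 1 M).erase n, (a t)⁻¹
      = (∑ t ∈ Finset.Icc 1 M, (a t)⁻¹) - (a n)⁻¹ := by
    rw [← Finset.add_sum_erase _ _ hn]; ring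
  have hpos : ∀ t ∈ (Finset.Icc 1 M).erase n, 0 < a t := fun t ht =>
    ha t (Finset.mem_of_mem_erase ht)
  have hT0 : 0 ≤ ∑ t ∈ (Finset.Icc 1 M).erase n,
      ((1 + a n / (2 * N)) * (1 + a t / (2 * N)))⁻¹ := by
    apply Finset.sum_nonneg
    intro t ht
    have := hpos t ht
    positivity
  have hT : (∑ t ∈ (Finset.Icc 1 M).erase n,
      ((1 + a n / (2 * N)) * (1 + a t / (2 * N)))⁻¹) * (1 + a n / N)
      ≤ 4 * N * ∑ t ∈ (Finset.Icc 1 M).erase n, (a t)⁻¹ := by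
    rw [Finset.sum_mul, Finset.mul_sum]
    apply Finset.sum_le_sum
    intro t ht
    have hat := hpos t ht
    have e : ((1 + a n / (2 * N)) * (1 + a t / (2 * N)))⁻¹ * (1 + a n / N)
        = (4 * N * (N + a n)) / ((2 * N + a n) * (2 * N + a t)) := by
      field_simp
      ring
    rw [e, ← div_eq_mul_inv, div_le_div_iff₀ (by positivity) hat]
    have h1 : (N + a n) * a t ≤ (2 * N + a n) * (2 * N + a t) := by
      apply mul_le_mul <;> nlinarith
    nlinarith [mul_le_mul_of_nonneg_left h1 (by positivity : 0 ≤ 4 * N)]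
  set T := ∑ t ∈ (Finset.Icc 1 M).erase n,
      ((1 + a n / (2 * N)) * (1 + a t / (2 * N)))⁻¹ with hTdef
  have hp : 0 < 1 + a n / N := by positivity
  have hp1 : 0 < 1 + a 1 / N := by positivity
  have hB : 0 < (1 + a n / N)⁻¹ + T := by positivity
  have h2 : a n * (1 + a 1 / N) ≤ a 1 * (1 + a n / N) := by
    have : a n * (a 1 / N) = a 1 * (a n / N) := by ring
    nlinarith
  have h3 := Real.log_le_log (by positivity) h2
  rw [Real.log_mul han.ne' hp1.ne', Real.log_mul ha1.ne' hp.ne'] at h3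
  have h4 := Real.log_le_sub_one_of_pos (mul_pos hB hp)
  rw [Real.log_mul hB.ne' hp.ne', add_mul, inv_mul_cancel₀ hp.ne'] at h4
  rw [hsum] at hT
  linarith

/-- Theorem 2: for a SPIM-mmWave system with `M ≥ 2` spatial paths and a single
RF chain (dominant path 1, i.e. `w₁g₁ ≥ w_n g_n`), if the geometric mean of the
non-dominant effective gains exceeds
`τ·w₁g₁` with `τ = M^{−M/(M−1)}·exp(4N₀·Σ_n (w_n g_n)⁻¹)`, then
`I_SPIM(M, N₀) > log₂(1 + w₁g₁/N₀)`. -/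
theorem spim_beats_mmwave (M : ℕ) (hM : 2 ≤ M) (N₀ : ℝ) (hN₀ : 0 < N₀)
    (w g : ℕ → ℝ) (hw : ∀ n ∈ Finset.Icc 1 M, 0 < w n)
    (hg : ∀ n ∈ Finset.Icc 1 M, 0 < g n)
    (hdom : ∀ n ∈ Finset.Icc 1 M, w n * g n ≤ w 1 * g 1)
    (hcond : (∏ n ∈ Finset.Icc 2 M, w n * g n) ^ (((M : ℝ) - 1)⁻¹) >
      (M : ℝ) ^ (-(M : ℝ) / ((M : ℝ) - 1)) *
        Real.exp (4 * N₀ * ∑ n ∈ Finset.Icc 1 M, (w n * g n)⁻¹) * (w 1 * g 1)) :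
    Real.logb 2 M - (1 / M) * ∑ n ∈ Finset.Icc 1 M,
        Real.logb 2 ((1 + w n * g n / N₀)⁻¹ +
          ∑ t ∈ (Finset.Icc 1 M).erase n,
            ((1 + w n * g n / (2 * N₀)) * (1 + w t * g t / (2 * N₀)))⁻¹) >
      Real.logb 2 (1 + w 1 * g 1 / N₀) := by
  have main : ∀ a : ℕ → ℝ, (∀ n ∈ Finset.Icc 1 M, 0 < a n) →
      (∀ n ∈ Finset.Icc 1 M, a n ≤ a 1) →
      ((∏ n ∈ Finset.Icc 2 M, a n) ^ (((M : ℝ) - 1)⁻¹) >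
        (M : ℝ) ^ (-(M : ℝ) / ((M : ℝ) - 1)) *
          Real.exp (4 * N₀ * ∑ n ∈ Finset.Icc 1 M, (a n)⁻¹) * (a 1)) →
      Real.logb 2 M - (1 / M) * ∑ n ∈ Finset.Icc 1 M,
        Real.logb 2 ((1 + a n / N₀)⁻¹ +
          ∑ t ∈ (Finset.Icc 1 M).erase n,
            ((1 + a n / (2 * N₀)) * (1 + a t / (2 * N₀)))⁻¹) >
      Real.logb 2 (1 + a 1 / N₀) := by
    intro a ha hd hc
    have hMr : (2 : ℝ) ≤ M := by exact_mod_cast hM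
    have hM0 : (0 : ℝ) < M := by linarith
    have hM1 : (0 : ℝ) < (M : ℝ) - 1 := by linarith
    have ha1 : 0 < a 1 := ha 1 (Finset.mem_Icc.2 ⟨le_rfl, by omega⟩)
    have hpos2 : ∀ n ∈ Finset.Icc 2 M, 0 < a n := fun n hn => by
      rw [Finset.mem_Icc] at hn
      exact ha n (Finset.mem_Icc.2 ⟨by omega, hn.2⟩)
    have hP : 0 < ∏ n ∈ Finset.Icc 2 M, a n := Finset.prod_pos hpos2
    have hl := Real.log_lt_log (by positivity) hc
    rw [Real.log_rpow hP, Real.log_mul (by positivity) ha1.ne',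
      Real.log_mul (by positivity) (by positivity), Real.log_rpow hM0, Real.log_exp,
      Real.log_prod (fun n hn => (hpos2 n hn).ne')] at hl
    have hl2 := mul_lt_mul_of_pos_left hl hM1
    have e1 : ∀ x : ℝ, ((M : ℝ) - 1) * (((M : ℝ) - 1)⁻¹ * x) = x := fun x => by
      field_simp
    have e2 : ∀ x y z : ℝ, ((M : ℝ) - 1) * (-(M : ℝ) / ((M : ℝ) - 1) * x + y + z)
        = -(M : ℝ) * x + ((M : ℝ) - 1) * (y + z) := fun x y z => by
      field_simp
      ring
    rw [e1, e2] at hl2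
    have hsplit : ∑ n ∈ Finset.Icc 1 M, Real.log (a n)
        = Real.log (a 1) + ∑ n ∈ Finset.Icc 2 M, Real.log (a n) := by
      rw [← Finset.add_sum_Ioc_eq_sum_Icc (by omega : 1 ≤ M)]
      rfl
    have hb := Finset.sum_le_sum (fun n hn => spim_path_bound M N₀ hN₀ a ha hd n hn)
    simp only [Finset.sum_sub_distrib, Finset.sum_add_distrib, Finset.sum_const,
      Nat.card_Icc, Nat.add_sub_cancel, nsmul_eq_mul, ← Finset.mul_sum] at hb
    have hlog2 : 0 < Real.log 2 := Real.log_pos (by norm_num)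
    simp only [Real.logb, ← Finset.sum_div]
    rw [gt_iff_lt, ← mul_div_assoc, ← sub_div]
    apply div_lt_div_of_pos_right _ hlog2
    rw [lt_sub_iff_add_lt, ← lt_sub_iff_add_lt', one_div, inv_mul_lt_iff₀ hM0]
    nlinarith
  exact main (fun n => w n * g n) (fun n hn => mul_pos (hw n hn) (hg n hn)) hdom hcond
end

section
/- Let M ≥ 2 be an integer and w_n, g_n > 0 for n = 1, …, M. Define for N₀ > 0: I_SPIM(M, N₀) = log₂ M − (1/M)·Σ_{n=1}^{M} log₂[ (1 + w_n g_n/N₀)^{−1} + Σ_{t ≠ n} ( (1 + w_n g_n/(2N₀))·(1 + w_t g_t/(2N₀)) )^{−1} ] and I_mmWave(N₀) = log₂(1 + w₁g₁/N₀). Then I_SPIM(M, N₀) − I_mmWave(N₀) converges to log₂ M + (1/M)·Σ_{n=1}^{M} log₂(w_n g_n) − log₂(w₁g₁) as N₀ → 0⁺ (limit along positive N₀ tending to 0). -/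
open Finset Filter Set

/-- High-SNR asymptotics of the M-path SPIM-mmWave spectral-efficiency gap:
`I_SPIM(M, N₀) − I_mmWave(N₀) → log₂ M + (1/M)·Σ_n log₂(w_n g_n) − log₂(w₁g₁)`
as `N₀ → 0⁺`. -/
theorem spim_gap_tendsto (M : ℕ) (hM : 2 ≤ M)
    (w g : ℕ → ℝ) (hw : ∀ n ∈ Finset.Icc 1 M, 0 < w n)
    (hg : ∀ n ∈ Finset.Icc 1 M, 0 < g n) :
    Tendsto (fun N₀ : ℝ =>
        (Real.logb 2 M - (1 / M) * ∑ n ∈ Finset.Icc 1 M,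
            Real.logb 2 ((1 + w n * g n / N₀)⁻¹ +
              ∑ t ∈ (Finset.Icc 1 M).erase n,
                ((1 + w n * g n / (2 * N₀)) * (1 + w t * g t / (2 * N₀)))⁻¹))
          - Real.logb 2 (1 + w 1 * g 1 / N₀))
      (nhdsWithin 0 (Set.Ioi 0))
      (nhds (Real.logb 2 M +
        (1 / M) * ∑ n ∈ Finset.Icc 1 M, Real.logb 2 (w n * g n)
          - Real.logb 2 (w 1 * g 1))) := by
  have ha : ∀ n ∈ Finset.Icc 1 M, 0 < w n * g n := fun n hn => mul_pos (hw n hn) (hg n hn)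
  have h1 : 0 < w 1 * g 1 := ha 1 (Finset.mem_Icc.2 ⟨le_refl _, by omega⟩)
  generalize hA : (fun n => w n * g n) = a at *
  have hA' : ∀ n, w n * g n = a n := fun n => by rw [← hA]
  simp only [hA'] at *
  have hM0 : (M : ℝ) ≠ 0 := by
    have : M ≠ 0 := by omega
    exact_mod_cast this
  set F : ℕ → ℝ → ℝ := fun n N => (N + a n)⁻¹ +
    ∑ t ∈ (Finset.Icc 1 M).erase n, 4 * N * ((2 * N + a n) * (2 * N + a t))⁻¹ with hF
  have hFc : ∀ n ∈ Finset.Icc 1 M, Tendsto (F n) (nhds 0) (nhds (a n)⁻¹) := by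
    intro n hn
    have hc : ContinuousAt (F n) 0 := by
      have hn0 := (ha n hn).ne'
      refine ContinuousAt.add ?_ ?_
      · exact ContinuousAt.inv₀ (by fun_prop) (by simpa using hn0)
      · refine tendsto_finsetSum _ fun t ht => ?_
        have ht0 := (ha t (Finset.mem_of_mem_erase ht)).ne'
        refine ContinuousAt.mul (by fun_prop) ?_
        exact ContinuousAt.inv₀ (by fun_prop) (by simpa using ⟨hn0, ht0⟩)
    have h0 : F n 0 = (a n)⁻¹ := by simp [hF]
    rw [← h0]
    exact hc
  have key : Tendsto (fun N : ℝ => (Real.logb 2 M - (1 / M) * ∑ n ∈ Finset.Icc 1 M,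
      Real.logb 2 (F n N)) - Real.logb 2 (N + a 1)) (nhds 0)
      (nhds ((Real.logb 2 M - (1 / M) * ∑ n ∈ Finset.Icc 1 M,
      Real.logb 2 (a n)⁻¹) - Real.logb 2 (a 1))) := by
    refine Tendsto.sub (Tendsto.sub tendsto_const_nhds (Tendsto.mul tendsto_const_nhds
      (tendsto_finsetSum _ fun n hn => ?_))) ?_
    · exact (Real.continuousAt_logb (inv_pos.2 (ha n hn)).ne').tendsto.comp (hFc n hn)
    · refine (Real.continuousAt_logb h1.ne').tendsto.comp ?_
      have : ContinuousAt (fun N : ℝ => N + a 1) 0 := by fun_prop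
      simpa [ContinuousAt] using this
  simp only [Real.logb_inv, Finset.sum_neg_distrib, mul_neg, sub_neg_eq_add] at key
  refine (key.mono_left nhdsWithin_le_nhds).congr' ?_
  filter_upwards [self_mem_nhdsWithin] with N hN
  have hN : 0 < N := hN
  have e1 : ∀ n ∈ Finset.Icc 1 M, Real.logb 2 ((1 + a n / N)⁻¹ +
      ∑ t ∈ (Finset.Icc 1 M).erase n, ((1 + a n / (2 * N)) * (1 + a t / (2 * N)))⁻¹)
      = Real.logb 2 N + Real.logb 2 (F n N) := by
    intro n hn
    have han := ha n hn
    have hFp : 0 < F n N := by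
      refine add_pos_of_pos_of_nonneg (by positivity) (Finset.sum_nonneg fun t ht => ?_)
      have hat := ha t (Finset.mem_of_mem_erase ht)
      positivity
    rw [← Real.logb_mul hN.ne' hFp.ne']
    congr 1
    simp only [hF]
    rw [mul_add, Finset.mul_sum]
    congr 1
    · field_simp
    · refine Finset.sum_congr rfl fun t ht => ?_
      have hat := ha t (Finset.mem_of_mem_erase ht)
      have p1 : 2 * N + a n ≠ 0 := by positivity
      have p2 : 2 * N + a t ≠ 0 := by positivity
      have q1 : 1 + a n / (2 * N) = (2 * N + a n) / (2 * N) := by field_simp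
      have q2 : 1 + a t / (2 * N) = (2 * N + a t) / (2 * N) := by field_simp
      rw [q1, q2]
      field_simp
      ring
  have e2 : Real.logb 2 (1 + a 1 / N) = Real.logb 2 (N + a 1) - Real.logb 2 N := by
    rw [← Real.logb_div (by positivity) hN.ne']
    congr 1
    field_simp
  rw [Finset.sum_congr rfl e1, e2, Finset.sum_add_distrib]
  simp only [Finset.sum_const, Nat.card_Icc, add_tsub_cancel_right, nsmul_eq_mul]
  field_simp
  ring
end

section
/- Let M ≥ 2 be an integer and w_n, g_n > 0 for n = 1, …, M. Define for N₀ > 0: I_SPIM(M, N₀) = log₂ M − (1/M)·Σ_{n=1}^{M} log₂[ (1 + w_n g_n/N₀)^{−1} + Σ_{t ≠ n} ( (1 + w_n g_n/(2N₀))·(1 + w_t g_t/(2N₀)) )^{−1} ] and I_mmWave(N₀) = log₂(1 + w₁g₁/N₀). If ( Π_{n=2}^{M} w_n g_n )^{1/(M−1)} > M^{−M/(M−1)} · w₁g₁, then there exists ε > 0 such that for all N₀ with 0 < N₀ < ε, I_SPIM(M, N₀) > I_mmWave(N₀). (Corollary 2: in the high-SNR region, SPIM-mmWave with M spatial paths outperforms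 conventional mmWave beamforming whenever the geometric mean of the effective gains of paths 2 through M exceeds M^{−M/(M−1)} times the effective gain of path 1.) -/
open Finset

/-- Corollary 2: if the geometric mean of the effective gains of paths 2,…,M
exceeds `M^{−M/(M−1)}·w₁g₁`, then for all sufficiently small `N₀ > 0` the
SPIM-mmWave spectral efficiency strictly exceeds that of conventional mmWave
beamforming. -/
theorem spim_beats_mmwave_high_snr_M (M : ℕ) (hM : 2 ≤ M)
    (w g : ℕ → ℝ) (hw : ∀ n ∈ Finset.Icc 1 M, 0 < w n)
    (hg : ∀ n ∈ Finset.Icc 1 M, 0 < g n)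
    (hcond : (∏ n ∈ Finset.Icc 2 M, w n * g n) ^ (((M : ℝ) - 1)⁻¹) >
      (M : ℝ) ^ (-(M : ℝ) / ((M : ℝ) - 1)) * (w 1 * g 1)) :
    ∃ ε > 0, ∀ N₀ : ℝ, 0 < N₀ → N₀ < ε →
      Real.logb 2 M - (1 / M) * ∑ n ∈ Finset.Icc 1 M,
          Real.logb 2 ((1 + w n * g n / N₀)⁻¹ +
            ∑ t ∈ (Finset.Icc 1 M).erase n,
              ((1 + w n * g n / (2 * N₀)) * (1 + w t * g t / (2 * N₀)))⁻¹) >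
        Real.logb 2 (1 + w 1 * g 1 / N₀) := by
  have ha : ∀ n ∈ Finset.Icc 1 M, 0 < w n * g n := fun n hn => mul_pos (hw n hn) (hg n hn)
  generalize hA : (fun n => w n * g n) = a
  have hA' : ∀ n, w n * g n = a n := fun n => by rw [← hA]
  simp only [hA'] at *
  clear hA hA' hw hg
  have h1 : 1 ∈ Finset.Icc 1 M := by simp; omega
  have hMr : (2 : ℝ) ≤ M := by exact_mod_cast hM
  have hM1 : (0 : ℝ) < (M : ℝ) - 1 := by linarith
  have hM0 : (0 : ℝ) < (M : ℝ) := by linarith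
  -- the limit is positive
  have hlim : 0 < Real.logb 2 M - (1 / M) * ∑ n ∈ Finset.Icc 1 M, Real.logb 2 ((a n)⁻¹)
      - Real.logb 2 (a 1) := by
    have hsub : ∀ n ∈ Finset.Icc 2 M, 0 < a n := fun n hn => by
      apply ha; simp at hn ⊢; omega
    have hp : 0 < ∏ n ∈ Finset.Icc 2 M, a n := Finset.prod_pos hsub
    have hl := Real.logb_lt_logb (b := 2) (by norm_num)
      (mul_pos (Real.rpow_pos_of_pos hM0 _) (ha 1 h1)) hcond
    rw [Real.logb_mul (Real.rpow_pos_of_pos hM0 _).ne' (ha 1 h1).ne',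
      Real.logb_rpow_eq_mul_logb_of_pos hM0, Real.logb_rpow_eq_mul_logb_of_pos hp,
      Real.logb_prod _ _ (fun n hn => (hsub n hn).ne')] at hl
    have hs : ∑ n ∈ Finset.Icc 1 M, Real.logb 2 ((a n)⁻¹)
        = -(Real.logb 2 (a 1) + ∑ n ∈ Finset.Icc 2 M, Real.logb 2 (a n)) := by
      simp only [Real.logb_inv, Finset.sum_neg_distrib]
      rw [← Finset.add_sum_Ioc_eq_sum_Icc (by omega : 1 ≤ M)]
      rfl
    rw [hs]
    generalize ∑ n ∈ Finset.Icc 2 M, Real.logb 2 (a n) = S at *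
    generalize Real.logb 2 (a 1) = L at *
    generalize Real.logb 2 (M : ℝ) = K at *
    have e1 : K - 1 / (M : ℝ) * -(L + S) - L
        = ((M : ℝ) - 1) / M * (((M : ℝ) - 1)⁻¹ * S - (-(M : ℝ) / ((M : ℝ) - 1) * K + L)) := by
      field_simp
      ring
    rw [e1]
    exact mul_pos (div_pos hM1 hM0) (by linarith)
  let T : ℕ → ℝ → ℝ := fun n x => (x + a n)⁻¹ +
    ∑ t ∈ (Finset.Icc 1 M).erase n, 4 * x * ((2 * x + a n) * (2 * x + a t))⁻¹
  have hT0 : ∀ n, T n 0 = (a n)⁻¹ := fun n => by simp [T]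
  have hTc : ∀ n ∈ Finset.Icc 1 M, ContinuousAt (T n) 0 := by
    intro n hn
    have hn' := (ha n hn).ne'
    refine ContinuousAt.add (ContinuousAt.inv₀ (by fun_prop) (by simpa using hn')) ?_
    refine tendsto_finsetSum _ fun t ht => ?_
    have ht' := (ha t (Finset.mem_of_mem_erase ht)).ne'
    have : ContinuousAt (fun x : ℝ => 4 * x * ((2 * x + a n) * (2 * x + a t))⁻¹) 0 :=
      ContinuousAt.mul (by fun_prop)
        (ContinuousAt.inv₀ (by fun_prop) (by simpa using ⟨hn', ht'⟩))
    exact this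
  have hlogc : ∀ f : ℝ → ℝ, ContinuousAt f 0 → f 0 ≠ 0 →
      ContinuousAt (fun x => Real.logb 2 (f x)) 0 := fun f hf h0 => by
    unfold Real.logb
    exact (hf.log h0).div_const _
  have hF : ContinuousAt (fun x : ℝ => Real.logb 2 M
      - (1 / M) * ∑ n ∈ Finset.Icc 1 M, Real.logb 2 (T n x) - Real.logb 2 (x + a 1)) 0 := by
    refine ContinuousAt.sub (ContinuousAt.sub continuousAt_const
      (ContinuousAt.mul continuousAt_const ?_)) ?_
    · exact tendsto_finsetSum _ fun n hn => hlogc (T n) (hTc n hn)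
        (by rw [hT0]; exact (inv_pos.2 (ha n hn)).ne')
    · exact hlogc (fun x => x + a 1) (by fun_prop) (by simpa using (ha 1 h1).ne')
  have hev := hF.eventually (lt_mem_nhds (a := 0) (by simpa only [hT0, zero_add] using hlim))
  obtain ⟨ε, hε, hball⟩ := Metric.eventually_nhds_iff.1 hev
  refine ⟨ε, hε, fun x hx hxε => ?_⟩
  have hb := hball (y := x) (by simpa [abs_of_pos hx] using hxε)
  have hTp : ∀ n ∈ Finset.Icc 1 M, 0 < T n x := by
    intro n hn
    have := ha n hn
    refine add_pos_of_pos_of_nonneg (by positivity) (Finset.sum_nonneg fun t ht => ?_)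
    have := ha t (Finset.mem_of_mem_erase ht)
    positivity
  have hsum : ∑ n ∈ Finset.Icc 1 M,
          Real.logb 2 ((1 + a n / x)⁻¹ +
            ∑ t ∈ (Finset.Icc 1 M).erase n,
              ((1 + a n / (2 * x)) * (1 + a t / (2 * x)))⁻¹)
      = M * Real.logb 2 x + ∑ n ∈ Finset.Icc 1 M, Real.logb 2 (T n x) := by
    have : (M : ℝ) * Real.logb 2 x = ∑ n ∈ Finset.Icc 1 M, Real.logb 2 x := by simp
    rw [this, ← Finset.sum_add_distrib]
    refine Finset.sum_congr rfl fun n hn => ?_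
    rw [← Real.logb_mul hx.ne' (hTp n hn).ne']
    congr 1
    have := ha n hn
    simp only [T, mul_add, Finset.mul_sum]
    congr 1
    · field_simp
    · refine Finset.sum_congr rfl fun t ht => ?_
      have := ha t (Finset.mem_of_mem_erase ht)
      field_simp
      norm_num
  have h1p := ha 1 h1
  have hlast : Real.logb 2 (1 + a 1 / x) = Real.logb 2 (x + a 1) - Real.logb 2 x := by
    rw [← Real.logb_div (by positivity) hx.ne']
    congr 1
    field_simp
  rw [hsum, hlast, mul_add, ← mul_assoc, one_div_mul_cancel hM0.ne', one_mul]
  linarith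
end
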